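/- Proposition 3.2(i): Let G be a group and S : G → Matrix (2n×2n) ℝ a group homomorphism into the symplectic matrices (S(g₁·g₂) = S(g₁)·S(g₂), S(1) = 1, and every S(g) is symplectic). Suppose there exists a covariance matrix σ (a real symmetric matrix such that σ + i·Ω_n, viewed as a complex matrix, is positive semidefinite) with S(g) * σ * S(g)ᵀ = σ for all g ∈ G. Then there exists a symplectic matrix R such that for every g ∈ G the matrix R⁻¹ * S(g) * R is orthogonal (and symplectic). -/

import Mathlib

open Matrix ComplexOrder

noncomputable section

/-- The 2×2 standard symplectic form `Ω₁ = !![0,1; -1,0]`. -/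
def Omega1 : Matrix (Fin 2) (Fin 2) ℝ := !![0, 1; -1, 0]

/-- The 2n×2n standard symplectic form `Ω_n`, a block-diagonal matrix with `n` copies of `Ω₁`. -/
def OmegaN (n : ℕ) : Matrix (Fin 2 × Fin n) (Fin 2 × Fin n) ℝ :=
  Matrix.blockDiagonal fun _ => Omega1

/-- A real 2n×2n matrix is symplectic if `S * Ω_n * Sᵀ = Ω_n`. -/
def IsSymplectic {n : ℕ} (S : Matrix (Fin 2 × Fin n) (Fin 2 × Fin n) ℝ) : Prop :=
  S * OmegaN n * Sᵀ = OmegaN n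

section Helpers

open scoped MatrixOrder

variable {m : Type*} [Fintype m] [DecidableEq m]

/-- Square root of a positive definite real matrix, with commutation and uniqueness. -/
lemma aux_sqrt (P : Matrix m m ℝ) (hP : P.PosDef) :
    ∃ Q : Matrix m m ℝ, Q.PosDef ∧ Q * Q = P ∧ (∀ B, Commute P B → Commute Q B) ∧
      ∀ Q' : Matrix m m ℝ, Q'.PosSemidef → Q' * Q' = P → Q' = Q := by
  have h0 : (0 : Matrix m m ℝ) ≤ P := hP.posSemidef.nonneg
  have hQ : CFC.sqrt P * CFC.sqrt P = P := CFC.sqrt_mul_sqrt_self P h0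
  have hps : (CFC.sqrt P).PosSemidef := (CFC.sqrt_nonneg P).posSemidef
  refine ⟨CFC.sqrt P, ?_, hQ, ?_, ?_⟩
  · rw [hps.posDef_iff_isUnit]
    have : IsUnit (CFC.sqrt P * CFC.sqrt P) := by rw [hQ]; exact hP.isUnit
    exact ((Commute.refl (CFC.sqrt P)).isUnit_mul_iff.mp this).1
  · intro B hB
    rw [CFC.sqrt_eq_cfc]
    exact hB.cfc_nnreal _
  · intro Q' hQ' h
    exact (CFC.sqrt_unique h hQ'.nonneg).symm

lemma aux_posdef_inv (P : Matrix m m ℝ) (hP : P.PosDef) : P * P⁻¹ = 1 ∧ P⁻¹ * P = 1 := by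
  have := (Matrix.isUnit_iff_isUnit_det P).mp hP.isUnit
  exact ⟨Matrix.mul_nonsing_inv _ this, Matrix.nonsing_inv_mul _ this⟩

lemma aux_posdef_symm (P : Matrix m m ℝ) (hP : P.PosDef) : Pᵀ = P := by
  have := hP.isHermitian
  rwa [Matrix.IsHermitian, Matrix.conjTranspose_eq_transpose_of_trivial] at this

/-- If `S W Sᵀ = W` with `W² = -1` then `Sᵀ W S = W`. -/
lemma aux_symp_transpose (W S : Matrix m m ℝ) (hW : W * W = -1) (h : S * W * Sᵀ = W) :
    Sᵀ * W * S = W := by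
  have h1 : S * (W * Sᵀ * (-W)) = 1 := by
    rw [← mul_assoc, ← mul_assoc, h, mul_neg, hW, neg_neg]
  have h2 := mul_eq_one_comm.mp h1
  have h3 : -W * (W * Sᵀ * (-W) * S) = -W := by rw [h2, mul_one]
  have h4 : -W * (W * Sᵀ * (-W) * S) = (W * W) * (Sᵀ * W * S) := by noncomm_ring
  rw [h4, hW] at h3
  simpa using h3

lemma aux_sqrt_symp (W τ : Matrix m m ℝ) (hW : W * W = -1) (hWt : Wᵀ = -W)
    (hτ : τ.PosDef) (h : τ * W * τ = W) :
    ∃ R : Matrix m m ℝ, R.PosDef ∧ R * R = τ ∧ R * W * R = W := by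
  obtain ⟨R, hR, hRR, -, -⟩ := aux_sqrt τ hτ
  refine ⟨R, hR, hRR, ?_⟩
  obtain ⟨hi1, hi2⟩ := aux_posdef_inv τ hτ
  obtain ⟨hr1, hr2⟩ := aux_posdef_inv R hR
  obtain ⟨Q, hQ, hQQ, -, hu⟩ := aux_sqrt τ⁻¹ hτ.inv
  have e1 : R⁻¹ = Q := by
    apply hu _ hR.inv.posSemidef
    rw [← hRR, Matrix.mul_inv_rev]
  have e2 : Wᵀ * R * W = Q := by
    apply hu
    · simpa using hR.posSemidef.conjTranspose_mul_mul_same W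
    · have : τ⁻¹ * (τ * W * τ * W) = τ⁻¹ * (W * W) := by rw [h]
      rw [hWt]
      have h5 : (-W * R * W) * (-W * R * W) = -(-W * R * (W * W) * R * W) := by noncomm_ring
      rw [h5, hW]
      have h6 : τ⁻¹ * (τ * W * τ * W) = (τ⁻¹ * τ) * (W * τ * W) := by noncomm_ring
      rw [h6, hi2, one_mul, hW] at this
      have h7 : -(-W * R * -1 * R * W) = -(W * (R * R) * W) := by noncomm_ring
      rw [h7, hRR, this]; simp
  have e3 : R * (Wᵀ * R * W) = 1 := by rw [e2, ← e1, hr1]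
  have e4 : R * (Wᵀ * R * W) * W = W := by rw [e3, one_mul]
  rw [hWt] at e4
  have e5 : R * (-W * R * W) * W = -(R * W * R * (W * W)) := by noncomm_ring
  rw [e5, hW] at e4
  simpa using e4

lemma aux_exists_tau (W σ : Matrix m m ℝ) (hW : W * W = -1) (hWt : Wᵀ = -W)
    (hσ : σ.PosDef) :
    ∃ τ : Matrix m m ℝ, τ.PosDef ∧ τ * W * τ = W ∧
      ∀ S : Matrix m m ℝ, S * W * Sᵀ = W → S * σ * Sᵀ = σ → S * τ * Sᵀ = τ := by
  obtain ⟨p, hp, hpp, -, -⟩ := aux_sqrt σ hσ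
  obtain ⟨hq1, hq2⟩ := aux_posdef_inv p hp
  have hps := aux_posdef_symm p hp
  set q := p⁻¹ with hq
  set A := p * W * p with hA
  have hAt : Aᵀ = -A := by
    rw [hA, Matrix.transpose_mul, Matrix.transpose_mul, hps, hWt]; noncomm_ring
  have hAinv : A * -(q * W * q) = 1 := by
    have : A * -(q * W * q) = -(p * W * (p * q) * W * q) := by rw [hA]; noncomm_ring
    rw [this, hq1, mul_one, mul_assoc p W W, hW]
    simp [hq1]
  have hAU : IsUnit A := IsUnit.of_mul_eq_one _ hAinv
  have hP : (Aᵀ * A).PosDef := by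
    have := Matrix.PosDef.conjTranspose_mul_self A (Matrix.mulVec_injective_of_isUnit hAU)
    simpa using this
  obtain ⟨M, hM, hMM, hMc, -⟩ := aux_sqrt _ hP
  obtain ⟨hk1, hk2⟩ := aux_posdef_inv M hM
  set k := M⁻¹ with hk
  have hkc : ∀ B, Commute A B → k * B = B * k := by
    intro B hB
    have h1 : Commute M B := by
      apply hMc
      rw [hAt]
      exact (hB.neg_left).mul_left hB
    calc k * B = k * (B * M) * k := by
          rw [mul_assoc k, mul_assoc B, hk1, mul_one]
      _ = B * k := by rw [← h1.eq, ← mul_assoc, hk2, one_mul]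
  have hkA := hkc A (Commute.refl A)
  have hkk : k * k * A = q * W * q := by
    have h1 : k * k * (A * A) = -1 := by
      have : A * A = -(M * M) := by rw [hMM, hAt]; noncomm_ring
      rw [this, mul_neg, mul_assoc k, ← mul_assoc k M, hk2, one_mul, hk2]
    calc k * k * A = k * k * A * (A * -(q * W * q)) := by rw [hAinv, mul_one]
      _ = (k * k * (A * A)) * -(q * W * q) := by noncomm_ring
      _ = q * W * q := by rw [h1]; simp
  refine ⟨p * k * p, ?_, ?_, ?_⟩
  · have := hM.inv.conjTranspose_mul_mul_same (Matrix.mulVec_injective_of_isUnit hp.isUnit)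
    rwa [hp.isHermitian.eq] at this
  · calc p * k * p * W * (p * k * p) = p * k * (A * k) * p := by rw [hA]; noncomm_ring
      _ = p * (k * k * A) * p := by rw [← hkA]; noncomm_ring
      _ = (p * q) * W * (q * p) := by rw [hkk]; noncomm_ring
      _ = W := by rw [hq1, hq2]; simp
  · intro S hS hSσ
    have hS' := aux_symp_transpose W S hW hS
    have hc : Commute A (q * S * p) := by
      change A * (q * S * p) = (q * S * p) * A
      calc A * (q * S * p) = p * W * (p * q) * S * p := by rw [hA]; noncomm_ring
        _ = (q * p) * p * W * S * p := by rw [hq1, hq2]; simp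
        _ = q * (p * p) * W * S * p := by noncomm_ring
        _ = q * (S * σ * Sᵀ) * W * S * p := by rw [hpp, hSσ]
        _ = q * S * σ * (Sᵀ * W * S) * p := by noncomm_ring
        _ = (q * S * p) * A := by rw [hS', ← hpp, hA]; noncomm_ring
    have hO := hkc _ hc
    calc S * (p * k * p) * Sᵀ = (p * q) * S * p * k * p * Sᵀ := by rw [hq1]; noncomm_ring
      _ = p * ((q * S * p) * k) * p * Sᵀ := by noncomm_ring
      _ = p * k * q * (S * (p * p) * Sᵀ) := by rw [← hO]; noncomm_ring
      _ = p * k * (q * p) * p := by rw [hpp, hSσ, ← hpp]; noncomm_ring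
      _ = p * k * p := by rw [hq2]; simp

lemma aux_sigma_posdef (W σ : Matrix m m ℝ) (hW : W * W = -1) (hWt : Wᵀ = -W)
    (hσsymm : σ.IsSymm)
    (hσunc : (σ.map (Complex.ofReal : ℝ → ℂ) +
        Complex.I • W.map (Complex.ofReal : ℝ → ℂ)).PosSemidef) : σ.PosDef := by
  have key : ∀ (N : Matrix m m ℝ) (x : m → ℝ),
      N.map (Complex.ofReal : ℝ → ℂ) *ᵥ (fun i => (x i : ℂ)) = fun i => ((N *ᵥ x) i : ℂ) := by
    intro N x
    ext i
    simp [Matrix.mulVec, dotProduct]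
  refine Matrix.PosDef.of_dotProduct_mulVec_pos ?_ ?_
  · rw [Matrix.IsHermitian, Matrix.conjTranspose_eq_transpose_of_trivial]; exact hσsymm
  · intro x hx
    have hWx : x ⬝ᵥ (W *ᵥ x) = 0 := by
      have h1 : x ⬝ᵥ (W *ᵥ x) = x ⬝ᵥ (Wᵀ *ᵥ x) := by
        rw [Matrix.mulVec_transpose, dotProduct_comm x (x ᵥ* W), ← Matrix.dotProduct_mulVec]
      rw [hWt, Matrix.neg_mulVec, dotProduct_neg] at h1
      linarith
    have hval : star (fun i => (x i : ℂ)) ⬝ᵥ ((σ.map (Complex.ofReal : ℝ → ℂ) +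
        Complex.I • W.map (Complex.ofReal : ℝ → ℂ)) *ᵥ (fun i => (x i : ℂ)))
        = ((x ⬝ᵥ (σ *ᵥ x) : ℝ) : ℂ) := by
      rw [Matrix.add_mulVec, Matrix.smul_mulVec, key, key, dotProduct_add, dotProduct_smul]
      have h2 : ∀ y : m → ℝ, star (fun i => (x i : ℂ)) ⬝ᵥ (fun i => (y i : ℂ))
          = ((x ⬝ᵥ y : ℝ) : ℂ) := by
        intro y; simp [dotProduct]
      rw [h2, h2, hWx]; simp
    have hnn := hσunc.dotProduct_mulVec_nonneg (fun i => (x i : ℂ))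
    rw [hval] at hnn
    have hnn' : 0 ≤ x ⬝ᵥ (σ *ᵥ x) := by exact_mod_cast hnn
    rw [star_trivial]
    refine lt_of_le_of_ne hnn' fun h0 => hx ?_
    rw [← h0, Complex.ofReal_zero, hσunc.dotProduct_mulVec_zero_iff] at hval
    rw [Matrix.add_mulVec, Matrix.smul_mulVec, key, key] at hval
    have hWz : W *ᵥ x = 0 := by
      ext i
      have := congrArg Complex.im (congrFun hval i)
      simpa using this
    have : (W * W) *ᵥ x = 0 := by rw [← Matrix.mulVec_mulVec, hWz, Matrix.mulVec_zero]
    rw [hW, Matrix.neg_mulVec, Matrix.one_mulVec] at this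
    simpa using this

end Helpers

lemma OmegaN_sq (n : ℕ) : OmegaN n * OmegaN n = -1 := by
  have h : Omega1 * Omega1 = -1 := by
    ext i j; fin_cases i <;> fin_cases j <;> simp [Omega1, Matrix.mul_apply]
  rw [OmegaN, ← Matrix.blockDiagonal_mul, h]
  have := Matrix.blockDiagonal_neg (fun _ : Fin n => (1 : Matrix (Fin 2) (Fin 2) ℝ))
  rw [← Matrix.blockDiagonal_one, ← Matrix.blockDiagonal_neg]
  rfl

lemma OmegaN_transpose (n : ℕ) : (OmegaN n)ᵀ = -OmegaN n := by
  have h : Omega1ᵀ = -Omega1 := by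
    ext i j; fin_cases i <;> fin_cases j <;> simp [Omega1]
  rw [OmegaN, Matrix.blockDiagonal_transpose, h, ← Matrix.blockDiagonal_neg]
  rfl

/-- Proposition 3.2(i): a symplectic representation admitting an invariant covariance matrix
is symplectically equivalent to an orthogonal symplectic (passive) representation. -/
theorem symplectic_rep_equiv_passive (n : ℕ) {G : Type} [Group G]
    (S : G → Matrix (Fin 2 × Fin n) (Fin 2 × Fin n) ℝ)
    (hS1 : S 1 = 1) (hSmul : ∀ g h : G, S (g * h) = S g * S h)
    (hSsymp : ∀ g, IsSymplectic (S g))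
    (σ : Matrix (Fin 2 × Fin n) (Fin 2 × Fin n) ℝ)
    (hσsymm : σ.IsSymm)
    (hσunc : (σ.map (Complex.ofReal : ℝ → ℂ) +
        Complex.I • (OmegaN n).map (Complex.ofReal : ℝ → ℂ)).PosSemidef)
    (hσinv : ∀ g, S g * σ * (S g)ᵀ = σ) :
    ∃ R : Matrix (Fin 2 × Fin n) (Fin 2 × Fin n) ℝ, IsSymplectic R ∧
      ∀ g, (R⁻¹ * S g * R) * (R⁻¹ * S g * R)ᵀ = 1 ∧ IsSymplectic (R⁻¹ * S g * R) := by
  have hW := OmegaN_sq n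
  have hWt := OmegaN_transpose n
  have hσ := aux_sigma_posdef (OmegaN n) σ hW hWt hσsymm hσunc
  obtain ⟨τ, hτ, hτW, hinv⟩ := aux_exists_tau (OmegaN n) σ hW hWt hσ
  obtain ⟨R, hR, hRR, hRW⟩ := aux_sqrt_symp (OmegaN n) τ hW hWt hτ hτW
  obtain ⟨h1, h2⟩ := aux_posdef_inv R hR
  have hRt := aux_posdef_symm R hR
  have hRit := aux_posdef_symm _ hR.inv
  have hRi : R⁻¹ * OmegaN n * R⁻¹ = OmegaN n := by
    calc R⁻¹ * OmegaN n * R⁻¹ = R⁻¹ * (R * OmegaN n * R) * R⁻¹ := by rw [hRW]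
      _ = (R⁻¹ * R) * OmegaN n * (R * R⁻¹) := by noncomm_ring
      _ = OmegaN n := by rw [h1, h2]; simp
  refine ⟨R, ?_, fun g => ⟨?_, ?_⟩⟩
  · rw [IsSymplectic, hRt, hRW]
  · rw [Matrix.transpose_mul, Matrix.transpose_mul, hRt, hRit]
    calc R⁻¹ * S g * R * (R * ((S g)ᵀ * R⁻¹)) = R⁻¹ * (S g * (R * R) * (S g)ᵀ) * R⁻¹ := by
          noncomm_ring
      _ = (R⁻¹ * R) * (R * R⁻¹) := by
          rw [hRR, hinv _ (hSsymp g) (hσinv g), ← hRR]; noncomm_ring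
      _ = 1 := by rw [h1, h2, mul_one]
  · have hs : S g * OmegaN n * (S g)ᵀ = OmegaN n := hSsymp g
    rw [IsSymplectic, Matrix.transpose_mul, Matrix.transpose_mul, hRt, hRit]
    calc R⁻¹ * S g * R * OmegaN n * (R * ((S g)ᵀ * R⁻¹))
        = R⁻¹ * (S g * (R * OmegaN n * R) * (S g)ᵀ) * R⁻¹ := by noncomm_ring
      _ = OmegaN n := by rw [hRW, hs, hRi]
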